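/- arXiv:1308.3469 — 2 statements merged into one kernel-verified Lean document; each statement's English description precedes it below -/
import Mathlib

section
/- For every n ∈ ℕ and every real u there exists a unique polynomial Q of degree at most n with real coefficients (depending only on n and u) such that P_{2n}(x, u) = Q(x²) for all real x; and moreover, for this same polynomial Q and for all real x and c: ∑_{i=0}^{2n} (2n choose i) · P_i(x, u) · c^{2n−i} = Q( (x + c)² ). (This is the content of (15.31)–(15.32): the even Wick power :G^{2n}: equals Q(G²), and the shifted Wick power :(G+c)^{2n}: equals Q((G+c)²) for the same polynomial Q.) -/
/-- The Wick polynomial `P_n(x,u) = :x^n:` for variance `u`. -/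
noncomputable def wickP (n : ℕ) (x u : ℝ) : ℝ :=
  ∑ j ∈ Finset.range (n / 2 + 1),
    (-1) ^ j * ((n.choose (2 * j) : ℕ) : ℝ) *
      (((2 * j).factorial : ℝ) / ((j.factorial : ℝ) * 2 ^ j)) * u ^ j * x ^ (n - 2 * j)

theorem wick_inner (m k : ℕ) (x c : ℝ) :
    ∑ i ∈ Finset.range (m + 1), ((m.choose i : ℕ) : ℝ) * ((i.choose k : ℕ) : ℝ)
      * x ^ (i - k) * c ^ (m - i) = ((m.choose k : ℕ) : ℝ) * (x + c) ^ (m - k) := by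
  by_cases hk : k ≤ m
  · obtain ⟨d, rfl⟩ := Nat.exists_eq_add_of_le hk
    rw [show k + d + 1 = k + (d + 1) by ring, Finset.sum_range_add]
    rw [Finset.sum_eq_zero (s := Finset.range k), zero_add, Nat.add_sub_cancel_left, add_pow,
      Finset.mul_sum]
    · refine Finset.sum_congr rfl fun i hi => ?_
      have hi' : i ≤ d := by simpa [Nat.lt_succ_iff] using hi
      have h := Nat.choose_mul (n := k + d) (k := k + i) (s := k) (by omega)
      rw [Nat.add_sub_cancel_left, Nat.add_sub_cancel_left] at h
      have h' : (((k + d).choose (k + i) : ℕ) : ℝ) * (((k + i).choose k : ℕ) : ℝ)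
          = (((k + d).choose k : ℕ) : ℝ) * ((d.choose i : ℕ) : ℝ) := by exact_mod_cast h
      rw [h', Nat.add_sub_cancel_left, Nat.add_sub_add_left]
      ring
    · intro i hi
      rw [Nat.choose_eq_zero_of_lt (Finset.mem_range.1 hi)]
      simp
  · rw [Nat.choose_eq_zero_of_lt (n := m) (by omega)]
    rw [Finset.sum_eq_zero]
    · simp
    · intro i hi
      rw [Nat.choose_eq_zero_of_lt (n := i) (k := k) (by have := Finset.mem_range.1 hi; omega)]
      simp

theorem wickP_extend (m i : ℕ) (hi : i ≤ m) (x u : ℝ) :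
    wickP i x u = ∑ j ∈ Finset.range (m + 1),
    (-1) ^ j * ((i.choose (2 * j) : ℕ) : ℝ) *
      (((2 * j).factorial : ℝ) / ((j.factorial : ℝ) * 2 ^ j)) * u ^ j * x ^ (i - 2 * j) := by
  unfold wickP
  refine Finset.sum_subset ?_ ?_
  · intro j hj
    simp only [Finset.mem_range] at *
    omega
  · intro j _ hj
    simp only [Finset.mem_range] at hj
    rw [Nat.choose_eq_zero_of_lt (by omega)]
    simp

theorem wickP_shift (m : ℕ) (x c u : ℝ) :
    ∑ i ∈ Finset.range (m + 1), ((m.choose i : ℕ) : ℝ) * wickP i x u * c ^ (m - i)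
      = wickP m (x + c) u := by
  rw [wickP_extend m m le_rfl]
  have h1 : ∀ i ∈ Finset.range (m + 1), ((m.choose i : ℕ) : ℝ) * wickP i x u * c ^ (m - i)
      = ∑ j ∈ Finset.range (m + 1), ((-1) ^ j *
      (((2 * j).factorial : ℝ) / ((j.factorial : ℝ) * 2 ^ j)) * u ^ j) *
        (((m.choose i : ℕ) : ℝ) * ((i.choose (2 * j) : ℕ) : ℝ)
      * x ^ (i - 2 * j) * c ^ (m - i)) := by
    intro i hi
    rw [wickP_extend m i (by have := Finset.mem_range.1 hi; omega), Finset.mul_sum,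
      Finset.sum_mul]
    exact Finset.sum_congr rfl fun j _ => by ring
  rw [Finset.sum_congr rfl h1, Finset.sum_comm]
  refine Finset.sum_congr rfl fun j _ => ?_
  rw [← Finset.mul_sum, wick_inner]
  ring

/-- (15.31)–(15.32): there is a unique polynomial `Q` of degree at most `n` with
`P_{2n}(x,u) = Q(x²)` for all `x`, and for this same `Q` the shifted Wick power
satisfies `∑_{i=0}^{2n} (2n choose i) P_i(x,u) c^{2n−i} = Q((x+c)²)` for all `x, c`. -/
theorem wickP_even_eq_poly_sq (n : ℕ) (u : ℝ) :
    ∃ Q : Polynomial ℝ, Q.natDegree ≤ n ∧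
      (∀ x : ℝ, wickP (2 * n) x u = Q.eval (x ^ 2)) ∧
      (∀ x c : ℝ,
        (∑ i ∈ Finset.range (2 * n + 1),
            (((2 * n).choose i : ℕ) : ℝ) * wickP i x u * c ^ (2 * n - i))
          = Q.eval ((x + c) ^ 2)) ∧
      (∀ Q' : Polynomial ℝ, Q'.natDegree ≤ n →
        (∀ x : ℝ, wickP (2 * n) x u = Q'.eval (x ^ 2)) → Q' = Q) := by
  obtain ⟨Q, hQd, hQ⟩ : ∃ Q : Polynomial ℝ, Q.natDegree ≤ n ∧
      ∀ x : ℝ, wickP (2 * n) x u = Q.eval (x ^ 2) := by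
    refine ⟨∑ j ∈ Finset.range (n + 1), Polynomial.C ((-1) ^ j *
      (((2 * n).choose (2 * j) : ℕ) : ℝ) *
      (((2 * j).factorial : ℝ) / ((j.factorial : ℝ) * 2 ^ j)) * u ^ j) *
        Polynomial.X ^ (n - j), ?_, ?_⟩
    · refine Polynomial.natDegree_sum_le_of_forall_le _ _ fun j _ => ?_
      exact (Polynomial.natDegree_C_mul_X_pow_le _ _).trans (Nat.sub_le _ _)
    · intro x
      rw [Polynomial.eval_finset_sum, wickP, Nat.mul_div_cancel_left n two_pos]
      refine Finset.sum_congr rfl fun j _ => ?_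
      rw [Polynomial.eval_mul, Polynomial.eval_C, Polynomial.eval_pow, Polynomial.eval_X,
        ← pow_mul, Nat.mul_sub]
  refine ⟨Q, hQd, hQ, fun x c => ?_, fun Q' _ hQ' => ?_⟩
  · rw [wickP_shift, hQ]
  · refine Polynomial.eq_of_infinite_eval_eq _ _ ((Set.Ici_infinite (0 : ℝ)).mono ?_)
    intro y hy
    have h := (hQ' √y).symm.trans (hQ √y)
    rw [Real.sq_sqrt hy] at h
    exact h
end

section
/- (Analytic core of the toy-model isomorphism identity (15.21).) Let x, ℓ be real numbers, let u ≥ 0, and define L : ℕ → ℝ by the recursion L(0) = 1 and, for n ≥ 1, L(n) = ℓ^n − ∑_σ [ n! / ( (n − |σ|₊)! · ∏_{i≥1} σ(i)! ) ] · ( ∏_{i≥1} (u^i)^{σ(i)} ) · L(n − |σ|), the sum running over all finitely supported σ : {1,2,3,...} → ℕ with 1 ≤ |σ| and |σ|₊ ≤ n. Then for every real s with s·u < 1 and |s·u| < 1, the series ∑_{n=0}^∞ (s^n/n!) · [ ∑_{j=0}^{n} (n choose j) · ( P_{2j}(x,u) / 2^j ) · L(n−j) ] converges and equals (1 + u·s)^{−1/2}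 · exp( s·( x²/2 + ℓ ) / (1 + u·s) ). -/
open Finset

/-- `|σ| = ∑_{i≥1} i·σ(i)` for a finitely supported `σ : ℕ →₀ ℕ`. -/
def wdeg (σ : ℕ →₀ ℕ) : ℕ := σ.sum fun i k => i * k

/-- `|σ|₊ = ∑_{i≥1} (i+1)·σ(i)` for a finitely supported `σ : ℕ →₀ ℕ`. -/
def wdegp (σ : ℕ →₀ ℕ) : ℕ := σ.sum fun i k => (i + 1) * k

open Polynomial in
lemma hasSum_rising (a z : ℝ) (hz : |z| < 1) :
    HasSum (fun i : ℕ => (ascPochhammer ℝ i).eval a / (i.factorial : ℝ) * z ^ i)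
      ((1 - z) ^ (-a)) := by
  have h := Real.one_div_one_sub_rpow_hasFPowerSeriesOnBall_zero a
  have hm : z ∈ Metric.eball (0 : ℝ) 1 := by
    rw [← ENNReal.ofReal_one, Metric.eball_ofReal]
    simpa using hz
  have h2 := h.hasSum hm
  have h1z : (0 : ℝ) ≤ 1 - z := by have := (abs_lt.1 hz).2; linarith
  rw [zero_add, one_div, ← Real.rpow_neg h1z] at h2
  convert! h2 using 2 with i
  have h3 := Ring.factorial_nsmul_multichoose_eq_ascPochhammer a i
  rw [Polynomial.ascPochhammer_smeval_eq_eval, Ring.multichoose_eq] at h3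
  rw [← h3]
  have hi : (i.factorial : ℝ) ≠ 0 := by positivity
  simp
  field_simp

/-- terms of the double series -/
noncomputable def dterm (c z y : ℝ) (p : ℕ × ℕ) : ℝ :=
  (ascPochhammer ℝ p.2).eval ((p.1 : ℝ) + c) / (p.2.factorial : ℝ) * z ^ p.2 *
    (y ^ p.1 / (p.1.factorial : ℝ))

lemma dterm_inner (c z y : ℝ) (hz : |z| < 1) (k : ℕ) :
    HasSum (fun i => dterm c z y (k, i))
      ((1 - z) ^ (-c) * ((y / (1 - z)) ^ k / (k.factorial : ℝ))) := by
  have h1z : (0 : ℝ) < 1 - z := by have := (abs_lt.1 hz).2; linarith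
  have := (hasSum_rising (k + c) z hz).mul_right (y ^ k / (k.factorial : ℝ))
  convert! this using 1
  rw [neg_add, Real.rpow_add h1z, Real.rpow_neg h1z.le (k : ℝ), Real.rpow_natCast, div_pow]
  field_simp

lemma dterm_outer (c z y : ℝ) :
    HasSum (fun k : ℕ => (1 - z) ^ (-c) * ((y / (1 - z)) ^ k / (k.factorial : ℝ)))
      ((1 - z) ^ (-c) * Real.exp (y / (1 - z))) := by
  refine HasSum.mul_left _ ?_
  rw [Real.exp_eq_exp_ℝ]
  exact NormedSpace.expSeries_div_hasSum_exp _

lemma dterm_norm (c z y : ℝ) (hc : 0 ≤ c) (p : ℕ × ℕ) :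
    ‖dterm c z y p‖ = dterm c |z| |y| p := by
  have : 0 ≤ (ascPochhammer ℝ p.2).eval ((p.1 : ℝ) + c) := by
    induction p.2 with
    | zero => simp
    | succ m ih => rw [ascPochhammer_succ_eval]; positivity
  simp [dterm, abs_of_nonneg this]

lemma dterm_summable (c z y : ℝ) (hc : 0 ≤ c) (hz : |z| < 1) :
    Summable (fun p => ‖dterm c z y p‖) := by
  have hz' : |(|z|)| < 1 := by rwa [abs_abs]
  simp_rw [dterm_norm c z y hc]
  rw [summable_prod_of_nonneg]
  · refine ⟨fun k => (dterm_inner c |z| |y| hz' k).summable, ?_⟩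
    simp_rw [(dterm_inner c |z| |y| hz' _).tsum_eq]
    exact (dterm_outer c |z| |y|).summable
  · intro p
    simp only [Pi.zero_apply, ← dterm_norm c z y hc]
    positivity

lemma dterm_hasSum (c z y : ℝ) (hc : 0 ≤ c) (hz : |z| < 1) :
    HasSum (dterm c z y) ((1 - z) ^ (-c) * Real.exp (y / (1 - z))) := by
  have hs : Summable (dterm c z y) := (dterm_summable c z y hc hz).of_norm
  have := hs.hasSum.prod_fiberwise (dterm_inner c z y hz)
  rw [← this.unique (dterm_outer c z y)]
  exact hs.hasSum

/-- antidiagonal sums -/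
noncomputable def dcoef (c z y : ℝ) (n : ℕ) : ℝ := ∑ p ∈ antidiagonal n, dterm c z y p

lemma dcoef_summable (c z y : ℝ) (hc : 0 ≤ c) (hz : |z| < 1) :
    Summable (fun n => ‖dcoef c z y n‖) := by
  have h := (dterm_summable c z y hc hz)
  rw [← Finset.HasAntidiagonal.sigmaAntidiagonalEquivProd.summable_iff] at h
  have h2 := h.sigma
  refine Summable.of_nonneg_of_le (fun _ => norm_nonneg _) (fun n => ?_) h2
  rw [tsum_fintype, dcoef]
  refine (norm_sum_le _ _).trans (le_of_eq ?_)
  rw [← Finset.sum_coe_sort]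
  rfl

lemma dcoef_hasSum (c z y : ℝ) (hc : 0 ≤ c) (hz : |z| < 1) :
    HasSum (dcoef c z y) ((1 - z) ^ (-c) * Real.exp (y / (1 - z))) := by
  have h := (dterm_hasSum c z y hc hz)
  rw [← Finset.HasAntidiagonal.sigmaAntidiagonalEquivProd.hasSum_iff] at h
  refine h.sigma fun n => ?_
  convert! hasSum_fintype _ using 1
  rw [dcoef, ← Finset.sum_coe_sort]
  rfl

open PowerSeries in
lemma coeff_geom (N d : ℕ) (hd : d ≤ N) :
    coeff d ((∑ i ∈ range (N + 1), (X : PowerSeries ℝ) ^ i) ^ (N - d + 1)) =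
      ((N.choose d : ℕ) : ℝ) := by
  set G := ∑ i ∈ range (N + 1), (X : PowerSeries ℝ) ^ i with hG
  set m := N - d with hm
  have h1 := PowerSeries.mk_add_choose_mul_one_sub_pow_eq_one ℝ m
  set B : PowerSeries ℝ := PowerSeries.mk fun n => (((m + n).choose m : ℕ) : ℝ) with hB
  have h2 : G * (1 - X) = 1 - X ^ (N + 1) := by
    have := geom_sum_mul (X : PowerSeries ℝ) (N + 1)
    linear_combination -this
  have h3 : G ^ (m + 1) = (1 - X ^ (N + 1)) ^ (m + 1) * B := by
    rw [← h2, mul_pow, mul_assoc, mul_comm _ B, h1, mul_one]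
  have h4 : (X : PowerSeries ℝ) ^ (N + 1) ∣ G ^ (m + 1) - B := by
    have h5 := sub_dvd_pow_sub_pow (1 - (X : PowerSeries ℝ) ^ (N + 1)) 1 (m + 1)
    have h6 : (X : PowerSeries ℝ) ^ (N + 1) ∣ (1 - X ^ (N + 1)) ^ (m + 1) - 1 := by
      have h8 : (X : PowerSeries ℝ) ^ (N + 1) ∣ 1 - X ^ (N + 1) - 1 := ⟨-1, by ring⟩
      rw [one_pow] at h5
      exact h8.trans h5
    rw [h3]
    have : (1 - (X : PowerSeries ℝ) ^ (N + 1)) ^ (m + 1) * B - B =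
      ((1 - X ^ (N + 1)) ^ (m + 1) - 1) * B := by ring
    rw [this]
    exact h6.mul_right _
  have h7 := PowerSeries.X_pow_dvd_iff.1 h4 d (by omega)
  rw [map_sub, sub_eq_zero] at h7
  rw [h7, hB, coeff_mk, hm, Nat.sub_add_cancel hd, Nat.choose_symm hd]

lemma wdegp_eq (σ : ℕ →₀ ℕ) : wdegp σ = wdeg σ + σ.sum (fun _ k => k) := by
  simp only [wdegp, wdeg, Finsupp.sum, ← Finset.sum_add_distrib]
  exact Finset.sum_congr rfl fun i _ => by ring

lemma support_subset_of_wdegp (σ : ℕ →₀ ℕ) : σ.support ⊆ range (wdegp σ) := by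
  intro i hi
  have h1 : (i + 1) * σ i ≤ wdegp σ :=
    Finset.single_le_sum (f := fun i => (i + 1) * σ i) (fun _ _ => Nat.zero_le _) hi
  have h2 : 0 < σ i := Nat.pos_of_ne_zero (by simpa using hi)
  rw [mem_range]
  nlinarith

lemma sum_eq_of_sub (σ : ℕ →₀ ℕ) {s : Finset ℕ} (h : σ.support ⊆ s) :
    σ.sum (fun _ k => k) = ∑ i ∈ s, σ i :=
  Finsupp.sum_of_support_subset σ h _ (by simp)

lemma wdeg_eq_of_sub (σ : ℕ →₀ ℕ) {s : Finset ℕ} (h : σ.support ⊆ s) :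
    wdeg σ = ∑ i ∈ s, i * σ i :=
  Finsupp.sum_of_support_subset σ h _ (by simp)

/-- the number of compositions, weighted -/
lemma sum_level (N d : ℕ) (hd : d ≤ N) :
    ∑ σ ∈ (finsuppAntidiag (range (N + 1)) (N - d + 1)) with wdeg σ = d,
      ((N - d + 1).factorial : ℝ) / (σ.prod fun _ k => (k.factorial : ℝ)) =
      ((N.choose d : ℕ) : ℝ) := by
  rw [← coeff_geom N d hd, Finset.sum_pow_eq_sum_piAntidiag, map_sum]
  rw [Finset.sum_filter]
  refine Finset.sum_bij (fun σ _ => (σ : ℕ → ℕ)) ?_ ?_ ?_ ?_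
  · intro σ hσ
    rw [mem_finsuppAntidiag] at hσ
    rw [mem_piAntidiag]
    exact ⟨hσ.1, fun i hi => hσ.2 (by simpa using hi)⟩
  · intro a _ b _ h
    exact DFunLike.coe_injective h
  · intro f hf
    rw [mem_piAntidiag] at hf
    refine ⟨Finsupp.onFinset (range (N + 1)) f hf.2, ?_, rfl⟩
    rw [mem_finsuppAntidiag]
    exact ⟨hf.1, Finsupp.support_onFinset_subset⟩
  · intro σ hσ
    rw [mem_finsuppAntidiag] at hσ
    have h1 : ∏ i ∈ range (N + 1), ((PowerSeries.X : PowerSeries ℝ) ^ i) ^ σ i =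
        PowerSeries.X ^ wdeg σ := by
      rw [wdeg_eq_of_sub σ hσ.2, ← Finset.prod_pow_eq_pow_sum]
      exact Finset.prod_congr rfl fun i _ => by rw [pow_mul]
    have h2 := Nat.multinomial_spec (range (N + 1)) σ
    rw [hσ.1] at h2
    have h3 : (σ.prod fun _ k => (k.factorial : ℝ)) =
        ((∏ i ∈ range (N + 1), (σ i).factorial : ℕ) : ℝ) := by
      rw [Finsupp.prod_of_support_subset σ hσ.2 _ (by simp)]
      push_cast; rfl
    have h4 : ((N - d + 1).factorial : ℝ) / (σ.prod fun _ k => (k.factorial : ℝ)) =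
        (Nat.multinomial (range (N + 1)) σ : ℝ) := by
      rw [h3, ← h2]
      have : ((∏ i ∈ range (N + 1), (σ i).factorial : ℕ) : ℝ) ≠ 0 := by
        exact_mod_cast (Finset.prod_pos fun i _ => Nat.factorial_pos _).ne'
      push_cast at this ⊢
      field_simp
    rw [h4, h1, ← map_natCast (PowerSeries.C (R := ℝ)), PowerSeries.coeff_C_mul,
      PowerSeries.coeff_X_pow]
    by_cases h : wdeg σ = d
    · simp [h]
    · simp [h, Ne.symm h]

lemma wdeg_fill (σ : ℕ →₀ ℕ) (m : ℕ) : wdeg (σ + Finsupp.single 0 m) = wdeg σ := by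
  unfold wdeg
  rw [Finsupp.sum_add_index' (by simp) (by intros; ring), Finsupp.sum_single_index (by simp)]
  simp

lemma wdegp_fill (σ : ℕ →₀ ℕ) (m : ℕ) : wdegp (σ + Finsupp.single 0 m) = wdegp σ + m := by
  unfold wdegp
  rw [Finsupp.sum_add_index' (by simp) (by intros; ring), Finsupp.sum_single_index (by simp)]
  simp

lemma fact_fill (σ : ℕ →₀ ℕ) (h0 : σ 0 = 0) (m : ℕ) :
    ((σ + Finsupp.single 0 m).prod fun _ k => (k.factorial : ℝ)) =
      (m.factorial : ℝ) * σ.prod fun _ k => (k.factorial : ℝ) := by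
  rw [Finsupp.prod_add_index_of_disjoint, Finsupp.prod_single_index (by simp), mul_comm]
  rw [Finset.disjoint_left]
  intro i hi hi'
  have := Finsupp.support_single_subset hi'
  simp only [Finset.mem_singleton] at this
  subst this
  simp [h0] at hi

lemma upow (σ : ℕ →₀ ℕ) (u : ℝ) : (σ.prod fun i k => (u ^ i) ^ k) = u ^ wdeg σ := by
  simp only [wdeg, Finsupp.sum, Finsupp.prod, ← Finset.prod_pow_eq_pow_sum, pow_mul]

lemma finsum_eq (u : ℝ) (L : ℕ → ℝ) (N : ℕ) :
    (∑ᶠ σ ∈ {σ : ℕ →₀ ℕ | σ 0 = 0 ∧ 1 ≤ wdeg σ ∧ wdegp σ ≤ N + 1},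
        ((N + 1).factorial : ℝ) /
            (((N + 1 - wdegp σ).factorial : ℝ) * (σ.prod fun _ k => (k.factorial : ℝ)))
          * (σ.prod fun i k => (u ^ i) ^ k) * L (N + 1 - wdeg σ)) =
    ∑ d ∈ Icc 1 N, ((N + 1).factorial : ℝ) / ((N - d + 1).factorial : ℝ) * (N.choose d : ℝ) *
      u ^ d * L (N - d + 1) := by
  classical
  set F : (ℕ →₀ ℕ) → ℝ := fun σ => ((N + 1).factorial : ℝ) /
    (σ.prod fun _ k => (k.factorial : ℝ)) * u ^ wdeg σ * L (N + 1 - wdeg σ) with hF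
  set T : Finset (ℕ →₀ ℕ) := (Icc 1 N).biUnion fun d =>
    (finsuppAntidiag (range (N + 1)) (N - d + 1)).filter (fun σ => wdeg σ = d) with hT
  have memT : ∀ σ, σ ∈ T ↔ 1 ≤ wdeg σ ∧ wdegp σ = N + 1 := by
    intro σ
    simp only [hT, Finset.mem_biUnion, Finset.mem_filter, mem_finsuppAntidiag, Finset.mem_Icc]
    constructor
    · rintro ⟨d, hd, ⟨h1, h2⟩, h3⟩
      change ∑ i ∈ range (N + 1), σ i = _ at h1
      rw [wdegp_eq, sum_eq_of_sub σ h2]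
      omega
    · rintro ⟨h1, h2⟩
      have hs := support_subset_of_wdegp σ
      rw [h2] at hs
      have h3 := wdegp_eq σ
      rw [sum_eq_of_sub σ hs] at h3
      have h4 : ∑ i ∈ range (N + 1), σ i ≠ 0 := by
        intro h
        have : σ = 0 := by
          ext i
          by_cases hi : i ∈ range (N + 1)
          · simpa using (Finset.sum_eq_zero_iff.1 h) i hi
          · simpa using fun hh => hi (hs hh)
        subst this
        simp [wdeg] at h1
      exact ⟨wdeg σ, ⟨h1, by omega⟩, ⟨show ∑ i ∈ range (N + 1), σ i = _ by omega, hs⟩, rfl⟩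
  have hbij : Set.BijOn (fun σ : ℕ →₀ ℕ => σ + Finsupp.single 0 (N + 1 - wdegp σ))
      {σ : ℕ →₀ ℕ | σ 0 = 0 ∧ 1 ≤ wdeg σ ∧ wdegp σ ≤ N + 1} (T : Set (ℕ →₀ ℕ)) := by
    refine ⟨?_, ?_, ?_⟩
    · rintro σ ⟨h0, h1, h2⟩
      simp only [Finset.mem_coe, memT, wdeg_fill, wdegp_fill]
      omega
    · rintro σ ⟨h0, h1, h2⟩ τ ⟨k0, k1, k2⟩ h
      ext i
      rcases Nat.eq_zero_or_pos i with rfl | hi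
      · rw [h0, k0]
      · have := DFunLike.congr_fun h i
        simpa [Finsupp.single_apply, hi.ne'] using this
    · intro τ hτ
      rw [Finset.mem_coe, memT] at hτ
      have hdec : τ.erase 0 + Finsupp.single 0 (τ 0) = τ := Finsupp.erase_add_single 0 τ
      have e1 := wdeg_fill (τ.erase 0) (τ 0)
      have e2 := wdegp_fill (τ.erase 0) (τ 0)
      rw [hdec] at e1 e2
      refine ⟨τ.erase 0, ⟨by simp, by omega, by omega⟩, ?_⟩
      have : N + 1 - wdegp (τ.erase 0) = τ 0 := by omega
      simp only [this, hdec]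
  rw [finsum_mem_eq_of_bijOn (g := F) _ hbij, finsum_mem_coe_finset, hT, Finset.sum_biUnion]
  · refine Finset.sum_congr rfl fun d hd => ?_
    rw [Finset.mem_Icc] at hd
    rw [← sum_level N d hd.2]
    simp only [Finset.mul_sum, Finset.sum_mul]
    refine Finset.sum_congr rfl fun σ hσ => ?_
    rw [Finset.mem_filter] at hσ
    have : N + 1 - d = N - d + 1 := by omega
    have hp : ((N - d + 1).factorial : ℝ) ≠ 0 := by positivity
    simp only [hF, hσ.2, this]
    field_simp
  · intro a _ b _ hab
    simp only [Function.onFun, Finset.disjoint_left, Finset.mem_filter]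
    rintro σ ⟨_, h1⟩ ⟨_, h2⟩
    exact hab (h1.symm.trans h2)
  · rintro σ ⟨h0, h1, h2⟩
    simp only [hF, fact_fill σ h0, wdeg_fill, upow]

lemma recursion (ℓ u : ℝ) (L : ℕ → ℝ)
    (hL : ∀ n : ℕ, 1 ≤ n →
      L n = ℓ ^ n - ∑ᶠ σ ∈ {σ : ℕ →₀ ℕ | σ 0 = 0 ∧ 1 ≤ wdeg σ ∧ wdegp σ ≤ n},
        (n.factorial : ℝ) /
            (((n - wdegp σ).factorial : ℝ) * (σ.prod fun _ k => (k.factorial : ℝ)))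
          * (σ.prod fun i k => (u ^ i) ^ k) * L (n - wdeg σ)) (N : ℕ) :
    ∑ d ∈ range (N + 1), (N.choose d : ℝ) * u ^ d *
      (L (N - d + 1) / ((N - d + 1).factorial : ℝ)) = ℓ ^ (N + 1) / ((N + 1).factorial : ℝ) := by
  have h := hL (N + 1) (by omega)
  rw [finsum_eq] at h
  have hp : ((N + 1).factorial : ℝ) ≠ 0 := by positivity
  have hl : ℓ ^ (N + 1) = L (N + 1) + ∑ d ∈ Icc 1 N, ((N + 1).factorial : ℝ) /
      ((N - d + 1).factorial : ℝ) * (N.choose d : ℝ) * u ^ d * L (N - d + 1) := by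
    rw [h]; ring
  have hI : Icc 1 N = Ico (0 + 1) (N + 1) := by ext; simp
  rw [eq_div_iff hp, hl, hI, Finset.range_eq_Ico,
    Finset.sum_eq_sum_Ico_succ_bot (by omega), add_mul, Finset.sum_mul]
  congr 1
  · simp only [Nat.choose_zero_right, pow_zero, Nat.sub_zero]
    push_cast
    field_simp
  · refine Finset.sum_congr rfl fun d _ => ?_
    ring

/-- functional -/
noncomputable def phi (a : ℕ → ℝ) : Polynomial ℝ →ₗ[ℝ] ℝ :=
  Polynomial.lsum fun k => a k • LinearMap.id

lemma phi_X (a : ℕ → ℝ) (n : ℕ) : phi a (Polynomial.X ^ n) = a n := by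
  simp [phi, Polynomial.lsum_apply, ← Polynomial.monomial_one_right_eq_X_pow,
    Polynomial.sum_monomial_index]

open Polynomial in
lemma invert (a b : ℕ → ℝ) (u : ℝ)
    (h : ∀ N, ∑ d ∈ range (N + 1), (N.choose d : ℝ) * u ^ d * a (N - d) = b N) (N : ℕ) :
    a N = ∑ d ∈ range (N + 1), (N.choose d : ℝ) * (-u) ^ d * b (N - d) := by
  have key : ∀ (N : ℕ), phi a ((X + C u) ^ N) = b N := by
    intro N
    rw [← h N, add_comm, add_pow, map_sum]
    refine Finset.sum_congr rfl fun d _ => ?_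
    have : C u ^ d * X ^ (N - d) * ((N.choose d : ℕ) : ℝ[X]) =
      ((N.choose d : ℝ) * u ^ d) • X ^ (N - d) := by
      rw [smul_eq_C_mul]; simp; ring
    rw [this, map_smul, phi_X, smul_eq_mul]
  have h2 : (X : ℝ[X]) ^ N = (C (-u) + (X + C u)) ^ N := by simp
  rw [← phi_X a N, h2, add_pow, map_sum]
  refine Finset.sum_congr rfl fun d _ => ?_
  have : C (-u) ^ d * (X + C u) ^ (N - d) * ((N.choose d : ℕ) : ℝ[X]) =
      ((N.choose d : ℝ) * (-u) ^ d) • (X + C u) ^ (N - d) := by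
    rw [smul_eq_C_mul]; simp; ring
  rw [this, map_smul, key, smul_eq_mul]

lemma asc_nat (k i : ℕ) :
    (ascPochhammer ℝ i).eval ((k : ℝ) + 1) * (k.factorial : ℝ) = ((k + i).factorial : ℝ) := by
  induction i with
  | zero => simp
  | succ i ih =>
    rw [ascPochhammer_succ_eval, ← add_assoc, Nat.factorial_succ]
    push_cast
    rw [← ih]; ring

lemma asc_half (k i : ℕ) :
    (ascPochhammer ℝ i).eval ((k : ℝ) + 1 / 2) * 4 ^ i * ((k + i).factorial : ℝ) *
      ((2 * k).factorial : ℝ) = ((2 * (k + i)).factorial : ℝ) * (k.factorial : ℝ) := by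
  induction i with
  | zero => simp; ring
  | succ i ih =>
    rw [ascPochhammer_succ_eval, ← add_assoc, Nat.factorial_succ,
      show 2 * (k + i + 1) = 2 * (k + i) + 1 + 1 by ring, Nat.factorial_succ, Nat.factorial_succ]
    push_cast at ih ⊢
    linear_combination (4 * ((k : ℝ) + 1 / 2 + i) * (k + i + 1)) * ih

lemma wick_part (x u s : ℝ) (j : ℕ) :
    s ^ j / (j.factorial : ℝ) * (wickP (2 * j) x u / 2 ^ j) =
      dcoef (1 / 2) (-(u * s)) (s * x ^ 2 / 2) j := by
  rw [dcoef, ← Finset.Nat.sum_antidiagonal_swap, Finset.Nat.sum_antidiagonal_eq_sum_range_succ_mk,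
    wickP, Finset.sum_div, Finset.mul_sum, Nat.mul_div_cancel_left _ (by norm_num)]
  refine Finset.sum_congr rfl fun i hi => ?_
  obtain ⟨k, rfl⟩ : ∃ k, j = k + i := ⟨j - i, by rw [mem_range] at hi; omega⟩
  have e1 : 2 * (k + i) - 2 * i = 2 * k := by omega
  have e2 : k + i - i = k := by omega
  have hc := asc_half k i
  have hch := Nat.choose_mul_factorial_mul_factorial (show 2 * i ≤ 2 * (k + i) by omega)
  rw [e1] at hch
  have hch' : ((2 * (k + i)).choose (2 * i) : ℝ) * ((2 * i).factorial : ℝ) *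
    ((2 * k).factorial : ℝ) = ((2 * (k + i)).factorial : ℝ) := by exact_mod_cast hch
  rw [← hch'] at hc
  have h2k : ((2 * k).factorial : ℝ) ≠ 0 := by positivity
  have hc2 : (ascPochhammer ℝ i).eval ((k : ℝ) + 1 / 2) * 4 ^ i * ((k + i).factorial : ℝ) =
      ((2 * (k + i)).choose (2 * i) : ℝ) * ((2 * i).factorial : ℝ) * (k.factorial : ℝ) := by
    apply mul_right_cancel₀ h2k
    linear_combination hc
  simp only [dterm, Prod.swap, e1, e2]
  have hk : (k.factorial : ℝ) ≠ 0 := by positivity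
  have hki : ((k + i).factorial : ℝ) ≠ 0 := by positivity
  have hi' : (i.factorial : ℝ) ≠ 0 := by positivity
  have h4 : (4 : ℝ) ^ i = 2 ^ i * 2 ^ i := by rw [← mul_pow]; norm_num
  rw [h4] at hc2
  generalize (ascPochhammer ℝ i).eval ((k : ℝ) + 1 / 2) = A at hc2 ⊢
  rw [show -(u * s) = (-1) * u * s by ring]
  simp only [div_pow, mul_pow, pow_add, pow_mul]
  field_simp
  linear_combination (-(s ^ k * s ^ i * u ^ i * x ^ (k * 2))) * hc2

lemma L_part (ℓ u : ℝ) (L : ℕ → ℝ) (hL0 : L 0 = 1)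
    (hL : ∀ n : ℕ, 1 ≤ n →
      L n = ℓ ^ n - ∑ᶠ σ ∈ {σ : ℕ →₀ ℕ | σ 0 = 0 ∧ 1 ≤ wdeg σ ∧ wdegp σ ≤ n},
        (n.factorial : ℝ) /
            (((n - wdegp σ).factorial : ℝ) * (σ.prod fun _ k => (k.factorial : ℝ)))
          * (σ.prod fun i k => (u ^ i) ^ k) * L (n - wdeg σ)) (s : ℝ) (n : ℕ) :
    s ^ n / (n.factorial : ℝ) * L n = dcoef 0 (-(u * s)) (s * ℓ) n := by
  rcases n with _ | N
  · simp [dcoef, dterm, hL0]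
  have h := invert (fun m => L (m + 1) / ((m + 1).factorial : ℝ))
    (fun m => ℓ ^ (m + 1) / ((m + 1).factorial : ℝ)) u (recursion ℓ u L hL) N
  have h' : s ^ (N + 1) / ((N + 1).factorial : ℝ) * L (N + 1) =
    s ^ (N + 1) * (L (N + 1) / ((N + 1).factorial : ℝ)) := by ring
  rw [h', h, dcoef, Finset.Nat.sum_antidiagonal_succ]
  have h0 : dterm 0 (-(u * s)) (s * ℓ) (0, N + 1) = 0 := by
    simp [dterm]
  rw [h0, zero_add, ← Finset.Nat.sum_antidiagonal_swap,
    Finset.Nat.sum_antidiagonal_eq_sum_range_succ_mk, Finset.mul_sum]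
  refine Finset.sum_congr rfl fun i hi => ?_
  obtain ⟨k, rfl⟩ : ∃ k, N = k + i := ⟨N - i, by rw [mem_range] at hi; omega⟩
  have e2 : k + i - i = k := by omega
  have hch := Nat.choose_mul_factorial_mul_factorial (show i ≤ k + i by omega)
  rw [e2] at hch
  have hch' : ((k + i).choose i : ℝ) * (i.factorial : ℝ) * (k.factorial : ℝ) =
    ((k + i).factorial : ℝ) := by exact_mod_cast hch
  rw [← asc_nat] at hch'
  have hk : (k.factorial : ℝ) ≠ 0 := by positivity
  have hi' : (i.factorial : ℝ) ≠ 0 := by positivity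
  have hch2 := mul_right_cancel₀ hk hch'
  simp only [dterm, Prod.swap, e2, add_zero]
  push_cast
  rw [← hch2, show -(u * s) = -u * s by ring]
  simp only [mul_pow, pow_add]
  field_simp

theorem toy_isomorphism_generating (x ℓ u : ℝ) (hu : 0 ≤ u) (L : ℕ → ℝ)
    (hL0 : L 0 = 1)
    (hL : ∀ n : ℕ, 1 ≤ n →
      L n = ℓ ^ n - ∑ᶠ σ ∈ {σ : ℕ →₀ ℕ | σ 0 = 0 ∧ 1 ≤ wdeg σ ∧ wdegp σ ≤ n},
        (n.factorial : ℝ) /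
            (((n - wdegp σ).factorial : ℝ) * (σ.prod fun _ k => (k.factorial : ℝ)))
          * (σ.prod fun i k => (u ^ i) ^ k) * L (n - wdeg σ))
    (s : ℝ) (hs1 : s * u < 1) (hs2 : |s * u| < 1) :
    HasSum (fun n : ℕ => s ^ n / (n.factorial : ℝ) *
        ∑ j ∈ range (n + 1), ((n.choose j : ℕ) : ℝ) * (wickP (2 * j) x u / 2 ^ j) * L (n - j))
      ((1 + u * s) ^ (-(1 / 2) : ℝ) * Real.exp (s * (x ^ 2 / 2 + ℓ) / (1 + u * s))) := by
  have hz : |-(u * s)| < 1 := by rwa [abs_neg, mul_comm]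
  have h := hasSum_sum_range_mul_of_summable_norm
    (dcoef_summable (1 / 2) (-(u * s)) (s * x ^ 2 / 2) (by norm_num) hz)
    (dcoef_summable 0 (-(u * s)) (s * ℓ) le_rfl hz)
  rw [(dcoef_hasSum (1 / 2) (-(u * s)) (s * x ^ 2 / 2) (by norm_num) hz).tsum_eq,
    (dcoef_hasSum 0 (-(u * s)) (s * ℓ) le_rfl hz).tsum_eq] at h
  convert! h using 1
  · funext n
    rw [Finset.mul_sum]
    refine Finset.sum_congr rfl fun j hj => ?_
    rw [← wick_part, ← L_part ℓ u L hL0 hL]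
    obtain ⟨k, rfl⟩ : ∃ k, n = k + j := ⟨n - j, by rw [mem_range] at hj; omega⟩
    have e2 : k + j - j = k := by omega
    have hch := Nat.choose_mul_factorial_mul_factorial (show j ≤ k + j by omega)
    rw [e2] at hch ⊢
    have hch' : ((k + j).choose j : ℝ) * (j.factorial : ℝ) * (k.factorial : ℝ) =
      ((k + j).factorial : ℝ) := by exact_mod_cast hch
    have hk : (k.factorial : ℝ) ≠ 0 := by positivity
    have hj' : (j.factorial : ℝ) ≠ 0 := by positivity
    have hkj : ((k + j).factorial : ℝ) ≠ 0 := by positivity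
    have hcc : ((k + j).choose j : ℝ) / ((k + j).factorial : ℝ) =
        1 / (j.factorial : ℝ) * (1 / (k.factorial : ℝ)) := by
      field_simp
      linear_combination hch'
    rw [pow_add]
    linear_combination (s ^ k * s ^ j * (wickP (2 * j) x u / 2 ^ j) * L k) * hcc
  · rw [sub_neg_eq_add, neg_zero, Real.rpow_zero, one_mul, mul_assoc, ← Real.exp_add]
    congr 2
    ring
end
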